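/- There is a constant c such that for every n ≥ 4, every initial BST T_0 on [n], and every sequence of accessed elements s_1,…,s_m ∈ [n], the total cost of the path-balance algorithm serving these accesses starting from T_0 (the cost of one access being the length of its search path) is at most c·(n+m)·log n·log log n. In other words, path-balance has amortized access cost O(log n · log log n). -/

import Mathlib

namespace Paper

inductive BTree where
  | nil : BTree
  | node : BTree → ℕ → BTree → BTree
deriving DecidableEq

namespace BTree

def keys : BTree → Finset ℕ
  | nil => ∅
  | node l x r => insert x (keys l ∪ keys r)

def root? : BTree → Option ℕ
  | nil => none
  | node _ x _ => some x

def isBST : BTree → Prop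
  | nil => True
  | node l x r => (∀ y ∈ keys l, y < x) ∧ (∀ y ∈ keys r, x < y) ∧ isBST l ∧ isBST r

def subtree? (s : ℕ) : BTree → Option BTree
  | nil => none
  | node l x r => if s = x then some (node l x r) else if s < x then subtree? s l else subtree? s r

/-- The set of keys of the subtree rooted at `s` (∅ if `s` is not in the tree). -/
def subtreeKeys (T : BTree) (s : ℕ) : Finset ℕ := ((subtree? s T).map keys).getD ∅

/-- The search path to `s`, listed from the root downwards. -/
def pathList (s : ℕ) : BTree → List ℕ
  | nil => []
  | node l x r => if s = x then [x] else if s < x then x :: pathList s l else x :: pathList s r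

def pathSet (T : BTree) (s : ℕ) : Finset ℕ := (pathList s T).toFinset

def nodeDepth (s : ℕ) : BTree → ℕ
  | nil => 0
  | node l x r => if s = x then 0 else if s < x then nodeDepth s l + 1 else nodeDepth s r + 1

/-- Number of right-going edges on the path from the root to `s`. -/
def rightDepth (s : ℕ) : BTree → ℕ
  | nil => 0
  | node l x r => if s = x then 0 else if s < x then rightDepth s l else rightDepth s r + 1

/-- Number of left-going edges on the path from the root to `s`. -/
def leftDepth (s : ℕ) : BTree → ℕ
  | nil => 0
  | node l x r => if s = x then 0 else if s < x then leftDepth s l + 1 else leftDepth s r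

def leafCount : BTree → ℕ
  | nil => 0
  | node nil _ nil => 1
  | node l _ r => leafCount l + leafCount r

/-- The wing partition of a BST, each wing listed from its topmost node downwards. -/
def wings : BTree → List (List ℕ)
  | nil => []
  | node l x r =>
    match wings l with
    | [] => [x] :: wings r
    | wl :: rest => (x :: wl) :: (rest ++ wings r)

end BTree

open BTree

/-- The left-leaning path on `[n]`: `n` at the root, `1` at the deepest node. -/
def leftPathTree : ℕ → BTree
  | 0 => BTree.nil
  | n + 1 => BTree.node (leftPathTree n) (n + 1) BTree.nil

/-- Number of side alternations (w.r.t. `s`) between adjacent elements of a list. -/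
def sideAlt (s : ℕ) : List ℕ → ℕ
  | x :: y :: rest => (if (x < s ∧ s < y) ∨ (y < s ∧ s < x) then 1 else 0) + sideAlt s (y :: rest)
  | _ => 0

/-- The set of elements involved in side alternations (w.r.t. `s`) in a list. -/
def zigzagSet (s : ℕ) : List ℕ → Finset ℕ
  | x :: y :: rest =>
    (if (x < s ∧ s < y) ∨ (y < s ∧ s < x) then ({x, y} : Finset ℕ) else ∅) ∪ zigzagSet s (y :: rest)
  | _ => ∅

noncomputable def wsum (w : ℕ → ℝ) (X : Finset ℕ) : ℝ := ∑ b ∈ X, w b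

/-- Partial sum-of-logs potential of the set `X` in tree `T` (binary logarithm). -/
noncomputable def phiOn (w : ℕ → ℝ) (T : BTree) (X : Finset ℕ) : ℝ :=
  ∑ a ∈ X, Real.logb 2 (wsum w (subtreeKeys T a))

noncomputable def phiAll (w : ℕ → ℝ) (T : BTree) : ℝ := phiOn w T (keys T)

/-- A single access of a minimally self-adjusting BST algorithm: the accessed element `s`
becomes the root, the keys are unchanged, and every node off the search path keeps its
subtree; hence the search path is replaced by an after-tree rooted at `s` and the pendent
subtrees are reattached in the unique order-preserving way. -/
structure IsAccess (T : BTree) (s : ℕ) (T' : BTree) : Prop where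
  hT : isBST T
  hT' : isBST T'
  hs : s ∈ keys T
  hkeys : keys T' = keys T
  hroot : root? T' = some s
  hpendent : ∀ a ∈ keys T, a ∉ pathSet T s → subtree? a T' = subtree? a T

/-- The algorithm (viewed as the set of accesses it may perform) satisfies the access lemma
via the sum-of-logs potential. -/
def SatisfiesAL (Alg : BTree → ℕ → BTree → Prop) : Prop :=
  ∃ C : ℝ, 0 ≤ C ∧ ∀ T s T', Alg T s T' → ∀ w : ℕ → ℝ, (∀ i ∈ keys T, 0 < w i) →
    ((pathSet T s).card : ℝ) ≤
      phiAll w T - phiAll w T' + C * (1 + Real.logb 2 (wsum w (keys T) / w s))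

/-- `X` is subtree-disjoint (w.r.t. the tree after the access). -/
def SubtreeDisjoint (T' : BTree) (X : Finset ℕ) : Prop :=
  ∀ a ∈ X, ∀ b ∈ X, a ≠ b → subtreeKeys T' a ∩ subtreeKeys T' b = ∅

/-- `X` is monotone: all elements on one side of `s`, with equal right-depth
(resp. left-depth) in the after-tree.  (For nodes of the search path, depth in the
after-tree coincides with depth in `T'`.) -/
def IsMonotone (s : ℕ) (T' : BTree) (X : Finset ℕ) : Prop :=
  ((∀ x ∈ X, s < x) ∧ ∃ d, ∀ x ∈ X, rightDepth x T' = d) ∨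
  ((∀ x ∈ X, x < s) ∧ ∃ d, ∀ x ∈ X, leftDepth x T' = d)

/-- The after-tree minus its root can be partitioned into (at most) `k` monotone sets. -/
def MonotoneDecomp (T : BTree) (s : ℕ) (T' : BTree) (k : ℕ) : Prop :=
  ∃ M : Fin k → Finset ℕ,
    (∀ i, IsMonotone s T' (M i)) ∧
    (∀ i j, i ≠ j → Disjoint (M i) (M j)) ∧
    Finset.univ.biUnion M = pathSet T s \ {s}

/-- The leaves of the after-tree: path nodes having no path node as proper descendant in `T'`. -/
def afterLeaves (T : BTree) (s : ℕ) (T' : BTree) : Finset ℕ :=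
  (pathSet T s).filter (fun x => subtreeKeys T' x ∩ pathSet T s = {x})

/-- Rotate-to-root: `s` becomes the root and ancestor relations are otherwise preserved,
equivalently `T'(a) = T(a) ∩ (-∞,s)` for path nodes `a < s` and symmetrically for `a > s`. -/
def IsRotateToRoot (T : BTree) (s : ℕ) (T' : BTree) : Prop :=
  subtreeKeys T' s = keys T ∧
  ∀ a ∈ pathSet T s,
    (a < s → subtreeKeys T' a = (subtreeKeys T a).filter (fun b => b < s)) ∧
    (s < a → subtreeKeys T' a = (subtreeKeys T a).filter (fun b => s < b))

def pendTree : Option ℕ → BTree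
  | none => BTree.nil
  | some u => BTree.node BTree.nil u BTree.nil

def buildLeft (l : List (ℕ × Option ℕ)) : BTree :=
  l.foldl (fun t vc => BTree.node (pendTree vc.2) vc.1 t) BTree.nil

def buildRight (l : List (ℕ × Option ℕ)) : BTree :=
  l.foldl (fun t vc => BTree.node t vc.1 (pendTree vc.2)) BTree.nil

/-- Global view of splay: process the reversed search path `v₁, v₂, …` in pairs; if a pair
lies on the same side of `s`, the more ancestral element is removed from its path and
becomes a (pendant) child of the other.  Returns the two spines (elements `< s` and `> s`),
deepest first, each spine node with its optional pendant child. -/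
def splaySpines (s : ℕ) : List ℕ → List (ℕ × Option ℕ) × List (ℕ × Option ℕ)
  | [] => ([], [])
  | [v] => if v < s then ([(v, none)], []) else ([], [(v, none)])
  | v :: u :: rest =>
    let p := splaySpines s rest
    if v < s then
      if u < s then ((v, some u) :: p.1, p.2)
      else ((v, none) :: p.1, (u, none) :: p.2)
    else
      if u < s then ((u, none) :: p.1, (v, none) :: p.2)
      else (p.1, (v, some u) :: p.2)

/-- The after-tree of a splay access, built from the reversed search path without `s`. -/
def splayAfterTree (s : ℕ) (l : List ℕ) : BTree :=
  BTree.node (buildLeft (splaySpines s l).1) s (buildRight (splaySpines s l).2)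

/-- A splay access: a valid access whose after-tree (the restriction of `T'` to the search
path) is the splay after-tree. -/
def IsSplayAccess (T : BTree) (s : ℕ) (T' : BTree) : Prop :=
  IsAccess T s T' ∧
  ∀ x ∈ pathSet T s,
    subtreeKeys T' x ∩ pathSet T s = subtreeKeys (splayAfterTree s (pathList s T).reverse.tail) x

/-- A path-balance access: a valid access whose after-tree is a balanced BST of depth
`⌈log₂ (1 + |P|)⌉` rooted at `s`. -/
def IsPathBalanceAccess (T : BTree) (s : ℕ) (T' : BTree) : Prop :=
  IsAccess T s T' ∧
  ∀ x ∈ pathSet T s, nodeDepth x T' ≤ Nat.clog 2 (1 + (pathSet T s).card)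

def isParent (Q : BTree) (x y : ℕ) : Prop := pathList y Q = pathList x Q ++ [y]

/-- One step of a decomposition: a (descending) path `Pi` of `Q` is rearranged into a tree,
all other nodes keeping their subtrees. -/
def StepRel (Q Q' : BTree) (Pi : Finset ℕ) : Prop :=
  isBST Q' ∧ keys Q' = keys Q ∧
  (∃ l : List ℕ, l ≠ [] ∧ List.Chain' (isParent Q) l ∧ l.toFinset = Pi) ∧
  (∀ a ∈ keys Q, a ∉ Pi → subtree? a Q' = subtree? a Q)

/-- The transformation of the before-path `P0` (as a tree) into the after-tree `A` admits a
local decomposition with window size `wdw`. -/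
def HasLocalDecomp (s : ℕ) (P0 A : BTree) (wdw : ℕ) : Prop :=
  ∃ (k : ℕ) (Q : ℕ → BTree) (Ps : ℕ → Finset ℕ),
    1 ≤ k ∧ Q 0 = P0 ∧ Q k = A ∧
    (∀ i < k, StepRel (Q i) (Q (i + 1)) (Ps i)) ∧
    s ∈ Ps 0 ∧
    (∀ i, i + 1 < k → (Ps (i + 1) \ Ps i).Nonempty) ∧
    (∀ i, i + 1 < k → (Ps (i + 1) ∩ Ps i).Nonempty) ∧
    (∀ i j, i + 1 < j → j < k → Disjoint (Ps i \ Ps (i + 1)) (Ps j)) ∧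
    (∀ i < k, (Ps i).card ≤ wdw)

/-- The search path to `s` in `T`, as a tree (the before-path of the transformation). -/
def pathTree (s : ℕ) : BTree → BTree
  | BTree.nil => BTree.nil
  | BTree.node l x r =>
    if s = x then BTree.node BTree.nil x BTree.nil
    else if s < x then BTree.node (pathTree s l) x BTree.nil
    else BTree.node BTree.nil x (pathTree s r)

/-- `A` is the after-tree of the access `(T, s, T')`: the restriction of `T'` to the search path. -/
def IsAfterTree (T : BTree) (s : ℕ) (T' A : BTree) : Prop :=
  isBST A ∧ keys A = pathSet T s ∧
  ∀ x ∈ pathSet T s, subtreeKeys A x = subtreeKeys T' x ∩ pathSet T s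

/-- The algorithm is local with window size `wdw`. -/
def IsLocal (Alg : BTree → ℕ → BTree → Prop) (wdw : ℕ) : Prop :=
  ∀ T s T', Alg T s T' → ∀ A, IsAfterTree T s T' A → HasLocalDecomp s (pathTree s T) A wdw

open scoped Classical in
noncomputable def stair (n : ℕ) (h : ℕ → ℕ) (s : ℕ) : Finset ℕ :=
  (Finset.Icc 1 n).filter
    (fun b => ∀ b' ∈ Finset.Icc 1 n, ((s < b' ∧ b' < b) ∨ (b < b' ∧ b' < s)) → h b' < h b)

open scoped Classical in
noncomputable def nbhd (n : ℕ) (h : ℕ → ℕ) (a : ℕ) : Finset ℕ :=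
  (Finset.Icc 1 n).filter
    (fun b => ∀ b' ∈ Finset.Icc 1 n, b' ≠ a → min a b ≤ b' → b' ≤ max a b → h b' < h a)

/-- Geometric sum-of-logs partial potential. -/
noncomputable def phiGeo (n : ℕ) (h : ℕ → ℕ) (w : ℕ → ℝ) (X : Finset ℕ) : ℝ :=
  ∑ a ∈ X, Real.logb 2 (wsum w (nbhd n h a))

/-- `l` is (the reversal of) a valid search path to `s`, without `s`, deepest element first. -/
def ValidRevPath (s : ℕ) (l : List ℕ) : Prop :=
  l.Nodup ∧ s ∉ l ∧
  l.Pairwise (fun a b => (a < s → b < s → b < a) ∧ (s < a → s < b → a < b))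

end Paper

namespace Paper

namespace BTree

lemma subtreeKeys_nil (s : ℕ) : subtreeKeys nil s = ∅ := rfl

lemma subtreeKeys_node (l r : BTree) (x s : ℕ) :
    subtreeKeys (node l x r) s =
      if s = x then keys (node l x r)
      else if s < x then subtreeKeys l s else subtreeKeys r s := by
  unfold subtreeKeys
  rw [subtree?]
  split_ifs <;> rfl

lemma mem_keys_node {l r : BTree} {x y : ℕ} :
    y ∈ keys (node l x r) ↔ y = x ∨ y ∈ keys l ∨ y ∈ keys r := by
  simp [keys]

lemma subtreeKeys_subset_keys (T : BTree) (s : ℕ) : subtreeKeys T s ⊆ keys T := by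
  induction T with
  | nil => simp [subtreeKeys_nil]
  | node l x r ihl ihr =>
    intro y hy
    rw [subtreeKeys_node] at hy
    rw [mem_keys_node]
    split_ifs at hy with h1 h2
    · exact mem_keys_node.1 hy
    · exact Or.inr (Or.inl (ihl hy))
    · exact Or.inr (Or.inr (ihr hy))

lemma mem_keys_left {l r : BTree} {x a : ℕ} (hT : isBST (node l x r))
    (ha : a ∈ keys (node l x r)) (h : a < x) : a ∈ keys l := by
  rcases mem_keys_node.1 ha with h1 | h1 | h1
  · omega
  · exact h1
  · have := hT.2.1 a h1
    omega

lemma mem_keys_right {l r : BTree} {x a : ℕ} (hT : isBST (node l x r))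
    (ha : a ∈ keys (node l x r)) (h : x < a) : a ∈ keys r := by
  rcases mem_keys_node.1 ha with h1 | h1 | h1
  · omega
  · have := hT.1 a h1
    omega
  · exact h1

lemma mem_subtreeKeys_self {T : BTree} (hT : isBST T) {a : ℕ} (ha : a ∈ keys T) :
    a ∈ subtreeKeys T a := by
  induction T with
  | nil => simp [keys] at ha
  | node l x r ihl ihr =>
    rw [subtreeKeys_node]
    split_ifs with h1 h2
    · exact ha
    · exact ihl hT.2.2.1 (mem_keys_left hT ha h2)
    · exact ihr hT.2.2.2 (mem_keys_right hT ha (by omega))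

lemma pathSet_subset_keys (T : BTree) (s : ℕ) : pathSet T s ⊆ keys T := by
  induction T with
  | nil => simp [pathSet, pathList]
  | node l x r ihl ihr =>
    intro y hy
    have ihl' : y ∈ pathList s l → y ∈ keys l := fun h => ihl (List.mem_toFinset.2 h)
    have ihr' : y ∈ pathList s r → y ∈ keys r := fun h => ihr (List.mem_toFinset.2 h)
    rw [mem_keys_node]
    rw [pathSet, List.mem_toFinset, pathList] at hy
    split_ifs at hy <;> simp only [List.mem_cons, List.not_mem_nil, or_false] at hy <;> tauto

lemma mem_pathSet_self {T : BTree} (hT : isBST T) {s : ℕ} (hs : s ∈ keys T) :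
    s ∈ pathSet T s := by
  rw [pathSet, List.mem_toFinset]
  induction T with
  | nil => simp [keys] at hs
  | node l x r ihl ihr =>
    rw [pathList]
    split_ifs with h1 h2
    · simp [h1]
    · exact List.mem_cons_of_mem _ (ihl hT.2.2.1 (mem_keys_left hT hs h2))
    · exact List.mem_cons_of_mem _ (ihr hT.2.2.2 (mem_keys_right hT hs (by omega)))

/-- The subtree of a search path node `a` contains every key between `s` and `a`. -/
lemma mem_subtreeKeys_of_between {T : BTree} (hT : isBST T) {s a k : ℕ}
    (ha : a ∈ pathSet T s) (hk : k ∈ keys T)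
    (hb : (s ≤ k ∧ k ≤ a) ∨ (a ≤ k ∧ k ≤ s)) : k ∈ subtreeKeys T a := by
  induction T with
  | nil => simp [keys] at hk
  | node l x r ihl ihr =>
    rw [subtreeKeys_node]
    split_ifs with h1 h2
    · exact hk
    all_goals
      rw [pathSet, List.mem_toFinset, pathList] at ha
      split_ifs at ha with h3 h4
      · simp at ha; omega
      all_goals
        rcases List.mem_cons.1 ha with h | h
        · omega
      all_goals
        first
        | exact ihl hT.2.2.1 (List.mem_toFinset.2 h) (mem_keys_left hT hk (by omega))
        | exact ihr hT.2.2.2 (List.mem_toFinset.2 h) (mem_keys_right hT hk (by omega))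
        | (have := hT.1 a (pathSet_subset_keys _ _ (List.mem_toFinset.2 h)); omega)
        | (have := hT.2.1 a (pathSet_subset_keys _ _ (List.mem_toFinset.2 h)); omega)

/-- Subtrees rooted at the same depth occupy disjoint intervals, ordered like their roots. -/
lemma lt_of_nodeDepth_eq {T : BTree} (hT : isBST T) {a b : ℕ} (ha : a ∈ keys T)
    (hb : b ∈ keys T) (hd : nodeDepth a T = nodeDepth b T) (hab : a < b) :
    ∀ k ∈ subtreeKeys T a, ∀ k' ∈ subtreeKeys T b, k < k' := by
  induction T with
  | nil => simp [keys] at ha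
  | node l x r ihl ihr =>
    intro k hk k' hk'
    rw [subtreeKeys_node] at hk hk'
    rw [nodeDepth, nodeDepth] at hd
    split_ifs at hd hk hk' <;> try omega
    · exact ihl hT.2.2.1 (mem_keys_left hT ha (by omega)) (mem_keys_left hT hb (by omega))
        (by omega) k hk k' hk'
    · exact (hT.1 k (subtreeKeys_subset_keys _ _ hk)).trans
        (hT.2.1 k' (subtreeKeys_subset_keys _ _ hk'))
    · exact ihr hT.2.2.2 (mem_keys_right hT ha (by omega)) (mem_keys_right hT hb (by omega))
        (by omega) k hk k' hk'

lemma lt_of_root {T : BTree} (hT : isBST T) {s a : ℕ} (hr : root? T = some s) (h : s < a) :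
    ∀ k ∈ subtreeKeys T a, s < k := by
  cases T with
  | nil => simp [root?] at hr
  | node l x r =>
    simp only [root?, Option.some.injEq] at hr
    subst hr
    intro k hk
    rw [subtreeKeys_node, if_neg (by omega), if_neg (by omega)] at hk
    exact hT.2.1 k (subtreeKeys_subset_keys _ _ hk)

lemma gt_of_root {T : BTree} (hT : isBST T) {s a : ℕ} (hr : root? T = some s) (h : a < s) :
    ∀ k ∈ subtreeKeys T a, k < s := by
  cases T with
  | nil => simp [root?] at hr
  | node l x r =>
    simp only [root?, Option.some.injEq] at hr
    subst hr
    intro k hk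
    rw [subtreeKeys_node, if_neg (by omega), if_pos h] at hk
    exact hT.1 k (subtreeKeys_subset_keys _ _ hk)

/-- Subtrees of search path nodes on one side of `s` grow with the distance from `s`. -/
lemma subtreeKeys_subset_of_between {T : BTree} (hT : isBST T) {s a b : ℕ}
    (ha : a ∈ pathSet T s) (hb : b ∈ pathSet T s)
    (hab : (s < a ∧ a < b) ∨ (b < a ∧ a < s)) : subtreeKeys T a ⊆ subtreeKeys T b := by
  induction T with
  | nil => simp [pathSet, pathList] at ha
  | node l x r ihl ihr =>
    rw [subtreeKeys_node _ _ _ b]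
    split_ifs with h1 h2
    · exact subtreeKeys_subset_keys _ _
    all_goals
      rw [pathSet, List.mem_toFinset, pathList] at ha hb
      split_ifs at ha hb with h3 h4
      · simp at ha hb; omega
      all_goals
        rcases List.mem_cons.1 hb with h | h
        · omega
        have hbk := pathSet_subset_keys _ _ (List.mem_toFinset.2 h)
      all_goals
        first
        | (have := hT.1 b hbk; omega)
        | (have := hT.2.1 b hbk; omega)
        | skip
      all_goals
        rcases List.mem_cons.1 ha with h' | h'
        · omega
        have hak := pathSet_subset_keys _ _ (List.mem_toFinset.2 h')
        rw [subtreeKeys_node, if_neg (by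
          first
          | have := hT.1 a hak; omega
          | have := hT.2.1 a hak; omega)]
    · rw [if_pos (hT.1 a hak)]
      exact ihl hT.2.2.1 (List.mem_toFinset.2 h') (List.mem_toFinset.2 h)
    · rw [if_neg (hT.2.1 a hak).not_gt]
      exact ihr hT.2.2.2 (List.mem_toFinset.2 h') (List.mem_toFinset.2 h)

end BTree

open BTree

lemma logb_two_add_le {x y M : ℝ} (hx : 1 ≤ x) (hy : 1 ≤ y) (h : x + y ≤ M) :
    Real.logb 2 x + Real.logb 2 y + 2 ≤ 2 * Real.logb 2 M := by
  have h4 : Real.logb 2 4 = 2 := by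
    rw [show (4 : ℝ) = 2 ^ (2 : ℝ) by norm_num, Real.logb_rpow (by norm_num) (by norm_num)]
  have h1 : Real.logb 2 x + Real.logb 2 y + 2 = Real.logb 2 (x * y * 4) := by
    rw [Real.logb_mul (by positivity) (by norm_num), Real.logb_mul (by positivity) (by positivity),
      h4]
  have h2 : 2 * Real.logb 2 M = Real.logb 2 (M ^ 2) := by
    rw [Real.logb_pow]; norm_num
  rw [h1, h2]
  apply Real.logb_le_logb_of_le (by norm_num) (by positivity)
  nlinarith [sq_nonneg (x - y)]

/-- If any two values of `f` fit together below each later value of `g`, then passing from `g`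
to `f` decreases the sum of logarithms by the number of summands, up to a logarithmic term. -/
lemma sum_logb_add_card_le {f g : ℕ → ℝ} (r : ℕ → ℕ) :
    ∀ (q : ℕ) (X : Finset ℕ) (M : ℝ), X.card = q → 1 ≤ M →
      Set.InjOn r X →
      (∀ a ∈ X, 1 ≤ f a ∧ 1 ≤ g a ∧ f a ≤ M) →
      (∀ a ∈ X, ∀ b ∈ X, r a < r b → f a + f b ≤ M) →
      (∀ a ∈ X, ∀ b ∈ X, r a < r b → f a ≤ g b ∧ g a ≤ g b) →
      (∀ a ∈ X, ∀ b ∈ X, ∀ c ∈ X, r a < r b → r b < r c → f a + f b ≤ g c) →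
      ∑ a ∈ X, (Real.logb 2 (f a) + 1 - Real.logb 2 (g a)) ≤ 1 + 2 * Real.logb 2 M := by
  intro q
  induction q using Nat.strong_induction_on with
  | _ q ih =>
    intro X M hq hM hinj h1 h2 h3 h4
    have hM0 : 0 ≤ Real.logb 2 M := Real.logb_nonneg (by norm_num) hM
    rcases X.eq_empty_or_nonempty with rfl | hne
    · simp; linarith
    obtain ⟨c, hc, hcmax⟩ := X.exists_max_image r hne
    have ltc : ∀ a ∈ X.erase c, r a < r c := fun a ha =>
      lt_of_le_of_ne (hcmax a (Finset.mem_of_mem_erase ha)) fun h =>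
        Finset.ne_of_mem_erase ha (hinj (Finset.mem_of_mem_erase ha) hc h)
    rw [← Finset.add_sum_erase X _ hc]
    rcases (X.erase c).eq_empty_or_nonempty with he | hne'
    · rw [he]
      have := Real.logb_le_logb_of_le (b := 2) (by norm_num)
        (by linarith [(h1 c hc).1]) (h1 c hc).2.2
      have := Real.logb_nonneg (b := 2) (by norm_num) (h1 c hc).2.1
      simp
      linarith
    obtain ⟨b, hb, hbmax⟩ := (X.erase c).exists_max_image r hne'
    have hbX := Finset.mem_of_mem_erase hb
    have hsub : ∀ a ∈ (X.erase c).erase b, a ∈ X := fun a ha =>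
      Finset.mem_of_mem_erase (Finset.mem_of_mem_erase ha)
    have ltb : ∀ a ∈ (X.erase c).erase b, r a < r b := fun a ha =>
      lt_of_le_of_ne (hbmax a (Finset.mem_of_mem_erase ha)) fun h =>
        Finset.ne_of_mem_erase ha (hinj (hsub a ha) hbX h)
    rw [← Finset.add_sum_erase _ _ hb]
    have hcard : ((X.erase c).erase b).card < q := by
      rw [Finset.card_erase_of_mem hb, Finset.card_erase_of_mem hc]
      have := Finset.card_pos.2 hne
      omega
    have key := ih _ hcard ((X.erase c).erase b) (g b) rfl (h1 b hbX).2.1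
      (fun a ha a' ha' h => hinj (hsub a ha) (hsub a' ha') h)
      (fun a ha => ⟨(h1 a (hsub a ha)).1, (h1 a (hsub a ha)).2.1,
        (h3 a (hsub a ha) b hbX (ltb a ha)).1⟩)
      (fun a ha a' ha' h => h4 a (hsub a ha) a' (hsub a' ha') b hbX h (ltb a' ha'))
      (fun a ha a' ha' h => h3 a (hsub a ha) a' (hsub a' ha') h)
      (fun a ha a' ha' a'' ha'' h h' =>
        h4 a (hsub a ha) a' (hsub a' ha') a'' (hsub a'' ha'') h h')
    have hpair := logb_two_add_le (h1 b hbX).1 (h1 c hc).1 (h2 b hbX c hc (ltc b hb))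
    have hg := Real.logb_le_logb_of_le (b := 2) (by norm_num)
      (by linarith [(h1 b hbX).2.1]) (h3 b hbX c hc (ltc b hb)).2
    linarith

/-- The sum-of-logs potential with unit weights. -/
noncomputable def unitPotential (T : BTree) : ℝ :=
  ∑ a ∈ keys T, Real.logb 2 ((subtreeKeys T a).card : ℝ)

lemma one_le_card_subtreeKeys {T : BTree} (hT : isBST T) {a : ℕ} (ha : a ∈ keys T) :
    (1 : ℝ) ≤ ((subtreeKeys T a).card : ℝ) := by
  exact_mod_cast Finset.card_pos.2 ⟨a, mem_subtreeKeys_self hT ha⟩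

lemma unitPotential_nonneg {T : BTree} (hT : isBST T) : 0 ≤ unitPotential T :=
  Finset.sum_nonneg fun _ ha =>
    Real.logb_nonneg (by norm_num) (one_le_card_subtreeKeys hT ha)

lemma logb_card_subtreeKeys_le {T : BTree} (hT : isBST T) {a : ℕ} (ha : a ∈ keys T) :
    Real.logb 2 ((subtreeKeys T a).card : ℝ) ≤ Real.logb 2 ((keys T).card : ℝ) := by
  apply Real.logb_le_logb_of_le (by norm_num)
  · linarith [one_le_card_subtreeKeys hT ha]
  · exact_mod_cast Finset.card_le_card (subtreeKeys_subset_keys T a)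

lemma unitPotential_le {T : BTree} (hT : isBST T) :
    unitPotential T ≤ ((keys T).card : ℝ) * Real.logb 2 ((keys T).card : ℝ) := by
  rw [← nsmul_eq_mul]
  exact Finset.sum_le_card_nsmul _ _ _ fun a ha => logb_card_subtreeKeys_le hT ha

/-- Search path nodes on the same side of `s` that end up at the same depth pay for themselves. -/
lemma IsAccess.sum_level_le {T T' : BTree} {s : ℕ} (h : IsAccess T s T') {X : Finset ℕ}
    (hX : X ⊆ pathSet T s) (hside : (∀ x ∈ X, s < x) ∨ (∀ x ∈ X, x < s))
    (hlevel : ∀ x ∈ X, ∀ y ∈ X, nodeDepth x T' = nodeDepth y T') :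
    ∑ a ∈ X, (Real.logb 2 ((subtreeKeys T' a).card : ℝ) + 1
        - Real.logb 2 ((subtreeKeys T a).card : ℝ))
      ≤ 1 + 2 * Real.logb 2 ((keys T).card : ℝ) := by
  have hk : ∀ x ∈ X, x ∈ keys T := fun x hx => pathSet_subset_keys T s (hX hx)
  have hk' : ∀ x ∈ X, x ∈ keys T' := fun x hx => h.hkeys ▸ hk x hx
  have hsubT : ∀ a, subtreeKeys T' a ⊆ keys T := fun a => h.hkeys ▸ subtreeKeys_subset_keys T' a
  have hself : ∀ x ∈ X, x ∈ subtreeKeys T' x := fun x hx => mem_subtreeKeys_self h.hT' (hk' x hx)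
  have hlt : ∀ a ∈ X, ∀ b ∈ X, a < b →
      ∀ k ∈ subtreeKeys T' a, ∀ k' ∈ subtreeKeys T' b, k < k' := fun a ha b hb hab =>
    lt_of_nodeDepth_eq h.hT' (hk' a ha) (hk' b hb) (hlevel a ha b hb) hab
  have hdisj : ∀ a ∈ X, ∀ b ∈ X, a ≠ b →
      Disjoint (subtreeKeys T' a) (subtreeKeys T' b) := by
    intro a ha b hb hab
    rw [Finset.disjoint_left]
    intro k hka hkb
    rcases lt_or_gt_of_ne hab with h' | h'
    · exact lt_irrefl _ (hlt a ha b hb h' k hka k hkb)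
    · exact lt_irrefl _ (hlt b hb a ha h' k hkb k hka)
  have hinto : ∀ a ∈ X, ∀ b ∈ X, (a - s) + (s - a) < (b - s) + (s - b) →
      subtreeKeys T' a ⊆ subtreeKeys T b := by
    intro a ha b hb hab k hka
    refine mem_subtreeKeys_of_between h.hT (hX hb) (hsubT a hka) ?_
    rcases hside with hs | hs
    · left
      have h1 := hs a ha
      have h2 := hs b hb
      have := hlt a ha b hb (by omega) k hka b (hself b hb)
      have := lt_of_root h.hT' h.hroot h1 k hka
      omega
    · right
      have h1 := hs a ha
      have h2 := hs b hb
      have := hlt b hb a ha (by omega) b (hself b hb) k hka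
      have := gt_of_root h.hT' h.hroot h1 k hka
      omega
  have hnest : ∀ a ∈ X, ∀ b ∈ X, (a - s) + (s - a) < (b - s) + (s - b) →
      subtreeKeys T a ⊆ subtreeKeys T b := by
    intro a ha b hb hab
    refine subtreeKeys_subset_of_between h.hT (hX ha) (hX hb) ?_
    rcases hside with hs | hs
    all_goals
      have h1 := hs a ha
      have h2 := hs b hb
      omega
  have hadd : ∀ a ∈ X, ∀ b ∈ X, (a - s) + (s - a) < (b - s) + (s - b) → ∀ Y : Finset ℕ,
      subtreeKeys T' a ⊆ Y → subtreeKeys T' b ⊆ Y →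
      ((subtreeKeys T' a).card : ℝ) + ((subtreeKeys T' b).card : ℝ) ≤ (Y.card : ℝ) := by
    intro a ha b hb hab Y h1 h2
    have hne : a ≠ b := by rintro rfl; omega
    have := Finset.card_le_card (Finset.union_subset h1 h2)
    rw [Finset.card_union_of_disjoint (hdisj a ha b hb hne)] at this
    exact_mod_cast this
  refine sum_logb_add_card_le (f := fun a => ((subtreeKeys T' a).card : ℝ))
    (g := fun a => ((subtreeKeys T a).card : ℝ)) (fun a => (a - s) + (s - a)) X.card X
    ((keys T).card : ℝ) rfl ?_ ?_ ?_ ?_ ?_ ?_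
  · exact_mod_cast Finset.card_pos.2 ⟨s, h.hs⟩
  · intro a ha b hb hab
    simp only at hab
    rcases hside with hs | hs <;>
    · have h1 := hs a ha
      have h2 := hs b hb
      omega
  · intro a ha
    exact ⟨one_le_card_subtreeKeys h.hT' (hk' a ha), one_le_card_subtreeKeys h.hT (hk a ha),
      by exact_mod_cast Finset.card_le_card (hsubT a)⟩
  · exact fun a ha b hb hab => hadd a ha b hb hab _ (hsubT a) (hsubT b)
  · exact fun a ha b hb hab => ⟨by exact_mod_cast Finset.card_le_card (hinto a ha b hb hab),
      by exact_mod_cast Finset.card_le_card (hnest a ha b hb hab)⟩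
  · exact fun a ha b hb c hc hab hbc =>
      hadd a ha b hb hab _ (hinto a ha c hc (hab.trans hbc)) (hinto b hb c hc hbc)

/-- Amortized cost of an access whose after-tree has depth at most `d`. -/
lemma IsAccess.card_pathSet_le {T T' : BTree} {s d : ℕ} (h : IsAccess T s T')
    (hd : ∀ x ∈ pathSet T s, nodeDepth x T' ≤ d) :
    ((pathSet T s).card : ℝ) ≤ unitPotential T - unitPotential T'
      + (2 * d + 3) * (1 + 2 * Real.logb 2 ((keys T).card : ℝ)) := by
  set L := Real.logb 2 ((keys T).card : ℝ) with hL
  set F : ℕ → ℝ := fun a => Real.logb 2 ((subtreeKeys T' a).card : ℝ) + 1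
        - Real.logb 2 ((subtreeKeys T a).card : ℝ) with hF
  have hL0 : 0 ≤ L := (Real.logb_nonneg (by norm_num) (one_le_card_subtreeKeys h.hT h.hs)).trans
    (logb_card_subtreeKeys_le h.hT h.hs)
  have hsP := mem_pathSet_self h.hT h.hs
  have hpot : unitPotential T' - unitPotential T =
      ∑ a ∈ pathSet T s, (Real.logb 2 ((subtreeKeys T' a).card : ℝ)
        - Real.logb 2 ((subtreeKeys T a).card : ℝ)) := by
    rw [unitPotential, unitPotential, h.hkeys, ← Finset.sum_sub_distrib]
    refine (Finset.sum_subset (pathSet_subset_keys T s) fun a ha hna => ?_).symm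
    rw [subtreeKeys, subtreeKeys, h.hpendent a ha hna, sub_self]
  have hsum : ∑ a ∈ pathSet T s, F a =
      unitPotential T' - unitPotential T + ((pathSet T s).card : ℝ) := by
    rw [hpot, Finset.card_eq_sum_ones, Nat.cast_sum, ← Finset.sum_add_distrib]
    refine Finset.sum_congr rfl fun a _ => ?_
    simp only [hF, Nat.cast_one]
    ring
  have hFs : F s ≤ 1 + 2 * L := by
    have h1 : Real.logb 2 ((subtreeKeys T' s).card : ℝ) ≤ L := by
      have := logb_card_subtreeKeys_le h.hT' (a := s) (h.hkeys ▸ h.hs)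
      rwa [h.hkeys] at this
    have h2 := Real.logb_nonneg (b := 2) (by norm_num) (one_le_card_subtreeKeys h.hT h.hs)
    simp only [hF]
    linarith
  have hrest : ∑ a ∈ (pathSet T s).erase s, F a ≤ (2 * d + 2) * (1 + 2 * L) := by
    have hmaps : ∀ x ∈ (pathSet T s).erase s, (decide (s < x), nodeDepth x T') ∈
        (Finset.univ : Finset Bool) ×ˢ Finset.range (d + 1) := by
      intro x hx
      have := hd x (Finset.mem_of_mem_erase hx)
      simp
      omega
    rw [← Finset.sum_fiberwise_of_maps_to hmaps]
    refine (Finset.sum_le_card_nsmul _ _ (1 + 2 * L) ?_).trans (le_of_eq ?_)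
    · rintro ⟨σ, j⟩ -
      refine h.sum_level_le ?_ ?_ ?_
      · exact (Finset.filter_subset _ _).trans (Finset.erase_subset _ _)
      · cases σ
        · right
          intro x hx
          simp at hx
          omega
        · left
          intro x hx
          simp at hx
          omega
      · intro x hx y hy
        simp at hx hy
        omega
    · rw [Finset.card_product, nsmul_eq_mul]
      rw [Finset.card_univ, Fintype.card_bool, Finset.card_range]
      push_cast
      ring
  rw [← Finset.add_sum_erase _ _ hsP] at hsum
  linarith

lemma logb_two_le_two_mul {x : ℝ} (hx : 0 < x) : Real.logb 2 x ≤ 2 * x := by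
  have h2 : (1 / 2 : ℝ) < Real.log 2 := by linarith [Real.log_two_gt_d9]
  rw [Real.logb, div_le_iff₀ (by linarith)]
  have := Real.log_le_sub_one_of_pos hx
  nlinarith

lemma natClog_two_le (k : ℕ) : (Nat.clog 2 k : ℝ) ≤ Real.logb 2 k + 1 := by
  have h := Real.natLog_le_logb k 2
  have : Nat.clog 2 k ≤ Nat.log 2 k + 1 :=
    Nat.clog_le_of_le_pow (Nat.lt_pow_succ_log_self (by norm_num) k).le
  have h' : (Nat.clog 2 k : ℝ) ≤ (Nat.log 2 k : ℝ) + 1 := by exact_mod_cast this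
  push_cast at h
  linarith

lemma IsPathBalanceAccess.card_pathSet_le {T T' : BTree} {s : ℕ}
    (h : IsPathBalanceAccess T s T') (hn : 4 ≤ (keys T).card) :
    ((pathSet T s).card : ℝ) ≤ 2 * (unitPotential T - unitPotential T')
      + 200 * (Real.logb 2 ((keys T).card : ℝ) * Real.logb 2 (Real.logb 2 ((keys T).card : ℝ))) := by
  have hmain := h.1.card_pathSet_le h.2
  have hclog := natClog_two_le (1 + (pathSet T s).card)
  set L := Real.logb 2 ((keys T).card : ℝ) with hL
  set p : ℝ := ((pathSet T s).card : ℝ) with hp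
  have hp0 : 0 ≤ p := Nat.cast_nonneg _
  have hL2 : 2 ≤ L := by
    rw [hL, Real.le_logb_iff_rpow_le (by norm_num) (by positivity)]
    norm_num
    exact_mod_cast hn
  have hLL : 1 ≤ Real.logb 2 L := by
    rw [Real.le_logb_iff_rpow_le (by norm_num) (by linarith)]
    norm_num
    exact hL2
  push_cast at hclog
  have h24 : Real.logb 2 24 ≤ 5 := by
    rw [Real.logb_le_iff_le_rpow (by norm_num) (by norm_num)]
    norm_num
  have hlog : Real.logb 2 (1 + p) ≤ 5 + Real.logb 2 L + 2 * ((1 + p) / (24 * L)) := by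
    have h1 := logb_two_le_two_mul (x := (1 + p) / (24 * L)) (by positivity)
    rw [Real.logb_div (by positivity) (by positivity),
      Real.logb_mul (by norm_num) (by positivity)] at h1
    linarith
  have hq : 6 * L * (2 * ((1 + p) / (24 * L))) = (1 + p) / 2 := by
    field_simp
    norm_num
  have hmul : (2 * (Nat.clog 2 (1 + (pathSet T s).card) : ℝ) + 3) * (1 + 2 * L) ≤
      (2 * Real.logb 2 (1 + p) + 5) * (3 * L) :=
    mul_le_mul (by linarith) (by linarith) (by linarith)
      (by have := Real.logb_nonneg (b := 2) (x := 1 + p) (by norm_num) (by linarith); linarith)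
  have hlog' := mul_le_mul_of_nonneg_left hlog (show 0 ≤ 6 * L by linarith)
  have hLLL : L ≤ L * Real.logb 2 L := le_mul_of_one_le_right (by linarith) hLL
  nlinarith

end Paper

open Paper Paper.BTree
/-- **Theorem.** Path-balance has amortized access cost `O(log n · log log n)`: for every
execution of the path-balance algorithm on `[n]` (`n ≥ 4`) serving `m` accesses, the total
cost is at most `c·(n+m)·log n·log log n`. -/
theorem path_balance_amortized :
    ∃ c : ℝ, 0 < c ∧ ∀ n : ℕ, 4 ≤ n → ∀ m : ℕ, ∀ (Ts : ℕ → BTree) (ss : ℕ → ℕ),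
      isBST (Ts 0) → keys (Ts 0) = Finset.Icc 1 n →
      (∀ i < m, ss i ∈ Finset.Icc 1 n) →
      (∀ i < m, IsPathBalanceAccess (Ts i) (ss i) (Ts (i + 1))) →
      ((∑ i ∈ Finset.range m, (pathSet (Ts i) (ss i)).card : ℕ) : ℝ) ≤
        c * ((n : ℝ) + (m : ℝ)) * Real.logb 2 n * Real.logb 2 (Real.logb 2 n) := by
  refine ⟨200, by norm_num, fun n hn m Ts ss hbst hkeys _ hacc => ?_⟩
  have inv : ∀ i ≤ m, isBST (Ts i) ∧ keys (Ts i) = Finset.Icc 1 n := by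
    intro i
    induction i with
    | zero => exact fun _ => ⟨hbst, hkeys⟩
    | succ i ih =>
      intro hi
      have h := (hacc i (by omega)).1
      exact ⟨h.hT', h.hkeys.trans (ih (by omega)).2⟩
  have hcard : ∀ i ≤ m, (keys (Ts i)).card = n := fun i hi => by rw [(inv i hi).2]; simp
  set L := Real.logb 2 (n : ℝ) with hL
  have hstep : ∀ i ∈ Finset.range m, ((pathSet (Ts i) (ss i)).card : ℝ) ≤
      2 * (unitPotential (Ts i) - unitPotential (Ts (i + 1))) + 200 * (L * Real.logb 2 L) := by
    intro i hi
    rw [Finset.mem_range] at hi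
    have := (hacc i hi).card_pathSet_le (by rw [hcard i hi.le]; exact hn)
    rwa [hcard i hi.le] at this
  have htotal := Finset.sum_le_sum hstep
  rw [Finset.sum_add_distrib, ← Finset.mul_sum,
    Finset.sum_range_sub' (fun i => unitPotential (Ts i)), Finset.sum_const, Finset.card_range,
    nsmul_eq_mul] at htotal
  have h0 := unitPotential_le hbst
  rw [hcard 0 (Nat.zero_le m)] at h0
  have hm := unitPotential_nonneg (inv m le_rfl).1
  have hn' : (4 : ℝ) ≤ n := by exact_mod_cast hn
  have hL2 : 2 ≤ L := by
    rw [hL, Real.le_logb_iff_rpow_le (by norm_num) (by linarith)]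
    norm_num
    exact hn
  have hLL : 1 ≤ Real.logb 2 L := by
    rw [Real.le_logb_iff_rpow_le (by norm_num) (by linarith)]
    norm_num
    exact hL2
  have hnL : (n : ℝ) * L ≤ n * L * Real.logb 2 L :=
    le_mul_of_one_le_right (by positivity) hLL
  have hnL0 : 0 ≤ (n : ℝ) * L := by positivity
  push_cast
  linarith
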